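/- Let B be a unital complex Banach algebra, (A,E) a B-valued Banach noncommutative probability space, a ∈ A, N ≥ 1, and fix i ∈ I. Then there exist α₀ ∈ B and bounded n-multilinear maps α_n : Bⁿ → B for n = 1, …, N such that, with X = L_i + Σ_{n=0}^{N} V_{i,n}(α_n) ∈ B(𝔉), one has ℰ(b₀ X b₁ X ⋯ b_k X) = E(b₀ a b₁ a ⋯ b_k a) for all k ∈ {1,…,N} and all b₀, …, b_N ∈ B (elements of B acting on 𝔉 via λ). -/

import Mathlib

open scoped Topology ENNReal

noncomputable section

variable (B : Type*) [NormedRing B] [NormedAlgebra ℂ B] [CompleteSpace B]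
variable (I : Type*) [DecidableEq I]

abbrev D := lp (fun _ : I => B) 1

def delta (i : I) : D B I := lp.single 1 i (1 : B)

def lsmul (b : B) (d : D B I) : D B I :=
  ⟨fun i => b * d i, by
    apply memℓp_gen
    have h1 : Summable fun i => ‖d i‖ ^ (1 : ℝ≥0∞).toReal :=
      (lp.memℓp d).summable (by norm_num)
    simp only [ENNReal.toReal_one, Real.rpow_one] at h1 ⊢
    exact Summable.of_nonneg_of_le (fun i => norm_nonneg _)
      (fun i => norm_mul_le b (d i)) (h1.mul_left ‖b‖)⟩

/-- The Fock-space construction of Dykema's paper: `F` plays the role of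
`𝔉 = BΩ ⊕ ⨁_{k ≥ 1} D^{⊗̂k} ⊗̂ B`, with `τ k d b₀` the elementary tensor
`d 0 ⊗ ⋯ ⊗ d k ⊗ b₀` (`k+1` factors from `D`), `lam` the left action of `B`,
`rho` the right action of `B`, `P` the projection onto `BΩ` and the operators
`L i`, `V i n αₙ`, `W i n αₙ` as defined in the paper. -/
structure FockSetup (F : Type*) [NormedAddCommGroup F] [NormedSpace ℂ F] [CompleteSpace F] where
  Ω : F
  τ : (k : ℕ) → (Fin (k + 1) → D B I) → B → F
  lam : B →ₐ[ℂ] (F →L[ℂ] F)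
  rho : B → (F →L[ℂ] F)
  P : F →L[ℂ] B
  L : I → (F →L[ℂ] F)
  V : (i : I) → (n : ℕ) → ContinuousMultilinearMap ℂ (fun _ : Fin n => B) B → (F →L[ℂ] F)
  W : (i : I) → (n : ℕ) → ContinuousMultilinearMap ℂ (fun _ : Fin n => B) B → (F →L[ℂ] F)
  dense_span : Dense (↑(Submodule.span ℂ
      ((Set.range fun b : B => lam b Ω) ∪
        {x | ∃ (k : ℕ) (d : Fin (k + 1) → D B I) (b₀ : B), x = τ k d b₀})) : Set F)
  lam_tensor : ∀ (b : B) (k : ℕ) (d : Fin (k + 1) → D B I) (b₀ : B),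
    lam b (τ k d b₀) = τ k (Function.update d 0 (lsmul B I b (d 0))) b₀
  rho_lam_omega : ∀ b b₀ : B, rho b (lam b₀ Ω) = lam (b₀ * b) Ω
  rho_tensor : ∀ (b : B) (k : ℕ) (d : Fin (k + 1) → D B I) (b₀ : B),
    rho b (τ k d b₀) = τ k d (b₀ * b)
  P_lam_omega : ∀ b : B, P (lam b Ω) = b
  P_tensor : ∀ (k : ℕ) (d : Fin (k + 1) → D B I) (b₀ : B), P (τ k d b₀) = 0
  L_omega : ∀ (i : I) (b₀ : B), L i (lam b₀ Ω) = τ 0 (fun _ => delta B I i) b₀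
  L_tensor : ∀ (i : I) (k : ℕ) (d : Fin (k + 1) → D B I) (b₀ : B),
    L i (τ k d b₀) = τ (k + 1) (Fin.cons (delta B I i) d) b₀
  V_zero : ∀ (i : I) (α : ContinuousMultilinearMap ℂ (fun _ : Fin 0 => B) B),
    V i 0 α = lam (α 0)
  W_zero : ∀ (i : I) (α : ContinuousMultilinearMap ℂ (fun _ : Fin 0 => B) B),
    W i 0 α = lam (α 0) * L i
  V_omega : ∀ (i : I) (n : ℕ), 1 ≤ n →
    ∀ (α : ContinuousMultilinearMap ℂ (fun _ : Fin n => B) B) (b₀ : B),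
      V i n α (lam b₀ Ω) = 0
  W_omega : ∀ (i : I) (n : ℕ), 1 ≤ n →
    ∀ (α : ContinuousMultilinearMap ℂ (fun _ : Fin n => B) B) (b₀ : B),
      W i n α (lam b₀ Ω) = 0
  V_tensor_lt : ∀ (i : I) (n : ℕ) (α : ContinuousMultilinearMap ℂ (fun _ : Fin n => B) B)
      (k : ℕ) (d : Fin (k + 1) → D B I) (b₀ : B), k + 1 < n →
    V i n α (τ k d b₀) = 0
  W_tensor_lt : ∀ (i : I) (n : ℕ) (α : ContinuousMultilinearMap ℂ (fun _ : Fin n => B) B)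
      (k : ℕ) (d : Fin (k + 1) → D B I) (b₀ : B), k + 1 < n →
    W i n α (τ k d b₀) = 0
  V_tensor_eq : ∀ (i : I) (k : ℕ) (α : ContinuousMultilinearMap ℂ (fun _ : Fin (k + 1) => B) B)
      (d : Fin (k + 1) → D B I) (b₀ : B),
    V i (k + 1) α (τ k d b₀) = lam (α (fun j => d j i) * b₀) Ω
  W_tensor_eq : ∀ (i : I) (k : ℕ) (α : ContinuousMultilinearMap ℂ (fun _ : Fin (k + 1) => B) B)
      (d : Fin (k + 1) → D B I) (b₀ : B),
    W i (k + 1) α (τ k d b₀) = lam (α (fun j => d j i)) (τ 0 (fun _ => delta B I i) b₀)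
  V_tensor_gt : ∀ (i : I) (n : ℕ), 1 ≤ n →
    ∀ (α : ContinuousMultilinearMap ℂ (fun _ : Fin n => B) B)
      (k : ℕ) (d : Fin (k + 1) → D B I) (b₀ : B) (h : n ≤ k),
    V i n α (τ k d b₀) =
      lam (α fun j => d (Fin.castLE (by omega) j) i)
        (τ (k - n) (fun j : Fin (k - n + 1) => d ⟨n + (j : ℕ), by omega⟩) b₀)
  W_tensor_gt : ∀ (i : I) (n : ℕ), 1 ≤ n →
    ∀ (α : ContinuousMultilinearMap ℂ (fun _ : Fin n => B) B)
      (k : ℕ) (d : Fin (k + 1) → D B I) (b₀ : B) (h : n ≤ k),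
    W i n α (τ k d b₀) =
      lam (α fun j => d (Fin.castLE (by omega) j) i)
        (τ (k - n + 1) (Fin.cons (delta B I i)
          (fun j : Fin (k - n + 1) => d ⟨n + (j : ℕ), by omega⟩)) b₀)

variable {B} {I}
variable {F : Type*} [NormedAddCommGroup F] [NormedSpace ℂ F] [CompleteSpace F]

/-- The expectation `ℰ(X) = P(XΩ)`. -/
def FockSetup.Ec (S : FockSetup B I F) (X : F →L[ℂ] F) : B := S.P (X S.Ω)

variable (B) in
/-- A `B`-valued Banach noncommutative probability space structure on `A`. -/
structure NCPS (A : Type*) [NormedRing A] [NormedAlgebra ℂ A] [CompleteSpace A] where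
  ι : B →ₐ[ℂ] A
  isometry : Isometry ι
  E : A →L[ℂ] B
  E_ι : ∀ b : B, E (ι b) = b
  cond_exp : ∀ (a : A) (b₁ b₂ : B), E (ι b₁ * a * ι b₂) = b₁ * E a * b₂

set_option linter.unusedSectionVars false

namespace FockSetup

variable (S : FockSetup B I F) (i : I)

/-- The vector `(c₀ δᵢ) ⊗ ⋯ ⊗ (c_{m-1} δᵢ) ⊗ c_m`, read as `c₀ Ω` when `m = 0`. -/
def word : (m : ℕ) → (Fin (m + 1) → B) → F
  | 0, c => S.lam (c 0) S.Ω
  | m + 1, c => S.τ m (fun j => lsmul B I (c j.castSucc) (delta B I i)) (c (Fin.last _))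

lemma lsmul_delta_self (b : B) : (lsmul B I b (delta B I i)) i = b := by
  change b * (lp.single 1 i (1 : B) : D B I) i = b
  rw [lp.single_apply_self, mul_one]

lemma lsmul_lsmul (b c : B) (d : D B I) : lsmul B I b (lsmul B I c d) = lsmul B I (b * c) d := by
  ext j
  exact (mul_assoc b c (d j)).symm

lemma one_lsmul (d : D B I) : lsmul B I 1 d = d := by
  ext j
  exact one_mul (d j)

lemma tensor_congr {k l : ℕ} (h : k = l) (d : Fin (k + 1) → D B I) (b₀ : B) :
    S.τ k d b₀ = S.τ l (fun j => d (Fin.cast (by omega) j)) b₀ := by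
  subst h
  rfl

lemma lam_word (b : B) (m : ℕ) (c : Fin (m + 1) → B) :
    S.lam b (S.word i m c) = S.word i m (Function.update c 0 (b * c 0)) := by
  cases m with
  | zero => simp [word]
  | succ m =>
    simp only [word, S.lam_tensor]
    congr 1
    · funext j
      rcases eq_or_ne j 0 with rfl | hj
      · simp [lsmul_lsmul]
      · have : j.castSucc ≠ 0 := by simpa using hj
        simp [hj]

lemma L_word (m : ℕ) (c : Fin (m + 1) → B) :
    S.L i (S.word i m c) = S.word i (m + 1) (Fin.cons 1 c) := by
  cases m with
  | zero =>
    simp only [word, S.L_omega]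
    congr 1
    funext j
    fin_cases j
    simp [one_lsmul]
  | succ m =>
    simp only [word, S.L_tensor]
    congr 1
    funext j
    refine Fin.cases ?_ (fun j => ?_) j
    · simp [one_lsmul]
    · simp only [Fin.cons_succ, Fin.castSucc_succ]

lemma V_word_of_lt {m n : ℕ} (h : m < n)
    (α : ContinuousMultilinearMap ℂ (fun _ : Fin n => B) B) (c : Fin (m + 1) → B) :
    S.V i n α (S.word i m c) = 0 := by
  cases m with
  | zero => exact S.V_omega i n h α _
  | succ m => exact S.V_tensor_lt i n α m _ _ h

lemma V_word_add (n p : ℕ) (α : ContinuousMultilinearMap ℂ (fun _ : Fin n => B) B)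
    (c : Fin (n + p + 1) → B) :
    S.V i n α (S.word i (n + p) c) =
      S.lam (α fun j => c ⟨j, by omega⟩) (S.word i p fun j => c ⟨n + j, by omega⟩) := by
  rcases n with _ | n
  · rw [S.V_zero]
    have : ∀ (q : ℕ) (h : q = p) (c : Fin (q + 1) → B),
        S.word i q c = S.word i p fun j => c ⟨0 + j, by omega⟩ := by
      rintro q rfl c
      congr 1
      funext j
      congr 1
      ext
      simp
    rw [this _ (Nat.zero_add p) c, Subsingleton.elim (0 : Fin 0 → B)]
  · rcases p with _ | p
    · refine (S.V_tensor_eq i n α _ _).trans ?_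
      simp only [lsmul_delta_self, map_mul, word]
      rfl
    · refine (S.V_tensor_gt i (n + 1) (by omega) α (n + 1 + p) _ _ (by omega)).trans ?_
      rw [S.tensor_congr (Nat.add_sub_cancel_left (n := n + 1) (m := p))]
      simp only [lsmul_delta_self, word]
      rfl

lemma P_lam (b : B) (x : F) : S.P (S.lam b x) = b * S.P x := by
  have hc : Continuous fun x => S.P (S.lam b x) := by fun_prop
  have hd : Continuous fun x => b * S.P x := by fun_prop
  refine congrFun (Continuous.ext_on S.dense_span hc hd fun y hy => ?_) x
  induction hy using Submodule.span_induction with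
  | mem y hy =>
    rcases hy with ⟨b₀, rfl⟩ | ⟨k, d, b₀, rfl⟩
    · have : S.lam b (S.lam b₀ S.Ω) = S.lam (b * b₀) S.Ω := by simp
      simp only [this, S.P_lam_omega]
    · simp only [S.lam_tensor, S.P_tensor, mul_zero]
  | zero => simp
  | add y z _ _ hy hz => simpa [mul_add] using congrArg₂ (· + ·) hy hz
  | smul r y _ hy => simpa using congrArg (r • ·) hy

/-- The families of vectors, parametrized by a space `T`, which are finite sums of words with
fewer than `m` factors `δᵢ` and continuously varying coefficients. -/
def wordFamily (T : Type*) [TopologicalSpace T] (m : ℕ) : AddSubmonoid (T → F) :=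
  AddSubmonoid.closure
    {ξ | ∃ n < m, ∃ c : T → Fin (n + 1) → B, Continuous c ∧ ξ = fun t => S.word i n (c t)}

section Family

variable {T : Type*} [TopologicalSpace T]

lemma word_mem_wordFamily {m n : ℕ} (h : n < m) {c : T → Fin (n + 1) → B} (hc : Continuous c) :
    (fun t => S.word i n (c t)) ∈ S.wordFamily i T m :=
  AddSubmonoid.subset_closure ⟨n, h, c, hc, rfl⟩

lemma wordFamily_mono {m n : ℕ} (h : m ≤ n) : S.wordFamily i T m ≤ S.wordFamily i T n :=
  AddSubmonoid.closure_mono fun _ ⟨k, hk, hc⟩ => ⟨k, hk.trans_le h, hc⟩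

/-- A family of additive maps sends `wordFamily m` to `M` as soon as it does so on words. -/
lemma map_mem_of_wordFamily {m : ℕ} {G : Type*} [AddCommMonoid G] {M : AddSubmonoid (T → G)}
    (f : T → F →+ G)
    (hf : ∀ n < m, ∀ c : T → Fin (n + 1) → B, Continuous c →
      (fun t => f t (S.word i n (c t))) ∈ M)
    {ξ : T → F} (hξ : ξ ∈ S.wordFamily i T m) : (fun t => f t (ξ t)) ∈ M := by
  induction hξ using AddSubmonoid.closure_induction with
  | mem ξ h =>
    obtain ⟨n, hn, c, hc, rfl⟩ := h
    exact hf n hn c hc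
  | zero =>
    simp only [Pi.zero_apply, map_zero]
    exact M.zero_mem
  | add ξ η _ _ hξ hη =>
    simp only [Pi.add_apply, map_add]
    exact M.add_mem hξ hη

lemma lam_mem_wordFamily {m : ℕ} {b : T → B} (hb : Continuous b) {ξ : T → F}
    (hξ : ξ ∈ S.wordFamily i T m) : (fun t => S.lam (b t) (ξ t)) ∈ S.wordFamily i T m := by
  refine S.map_mem_of_wordFamily i (fun t => (S.lam (b t) : F →+ F)) (fun n hn c hc => ?_) hξ
  simp only [AddMonoidHom.coe_coe, lam_word]
  refine S.word_mem_wordFamily i hn (c := fun t => Function.update (c t) 0 (b t * c t 0)) ?_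
  fun_prop

lemma L_mem_wordFamily {m : ℕ} {ξ : T → F} (hξ : ξ ∈ S.wordFamily i T m) :
    (fun t => S.L i (ξ t)) ∈ S.wordFamily i T (m + 1) := by
  refine S.map_mem_of_wordFamily i (fun _ => (S.L i : F →+ F)) (fun n hn c hc => ?_) hξ
  simp only [AddMonoidHom.coe_coe, L_word]
  exact S.word_mem_wordFamily i (by omega) (c := fun t => Fin.cons 1 (c t))
    (continuous_const.finCons hc)

lemma V_word_mem_wordFamily {m : ℕ} (n : ℕ)
    (α : ContinuousMultilinearMap ℂ (fun _ : Fin n => B) B)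
    {c : T → Fin (m + 1) → B} (hc : Continuous c) :
    (fun t => S.V i n α (S.word i m (c t))) ∈ S.wordFamily i T (m + 1) := by
  rcases lt_or_ge m n with h | h
  · simp only [S.V_word_of_lt i h]
    exact AddSubmonoid.zero_mem _
  · obtain ⟨p, rfl⟩ := Nat.exists_eq_add_of_le h
    simp only [V_word_add]
    have hα : Continuous fun t => α fun j => c t ⟨j, by omega⟩ :=
      α.cont.comp (by fun_prop)
    exact S.lam_mem_wordFamily i hα
      (S.word_mem_wordFamily i (c := fun t j => c t ⟨n + j, by omega⟩) (by omega) (by fun_prop))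

lemma V_mem_wordFamily {m : ℕ} (n : ℕ) (α : ContinuousMultilinearMap ℂ (fun _ : Fin n => B) B)
    {ξ : T → F} (hξ : ξ ∈ S.wordFamily i T m) :
    (fun t => S.V i n α (ξ t)) ∈ S.wordFamily i T m :=
  S.map_mem_of_wordFamily i (fun _ => (S.V i n α : F →+ F))
    (fun _ hk _ hc => S.wordFamily_mono i hk (S.V_word_mem_wordFamily i n α hc)) hξ

lemma V_eq_zero_of_mem_wordFamily {m n : ℕ} (h : m ≤ n)
    (α : ContinuousMultilinearMap ℂ (fun _ : Fin n => B) B)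
    {ξ : T → F} (hξ : ξ ∈ S.wordFamily i T m) (t : T) : S.V i n α (ξ t) = 0 := by
  have := S.map_mem_of_wordFamily i (M := ⊥) (fun _ => (S.V i n α : F →+ F))
    (fun k hk c _ => AddSubmonoid.mem_bot.2 <| funext fun t =>
      S.V_word_of_lt i (hk.trans_le h) α (c t)) hξ
  exact congrFun (AddSubmonoid.mem_bot.1 this) t

lemma P_word (m : ℕ) (c : Fin (m + 1) → B) :
    S.P (S.word i m c) = if m = 0 then c 0 else 0 := by
  cases m with
  | zero => simp [word, S.P_lam_omega]
  | succ m => simp [word, S.P_tensor]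

lemma continuous_P_of_mem_wordFamily {m : ℕ} {ξ : T → F} (hξ : ξ ∈ S.wordFamily i T m) :
    Continuous fun t => S.P (ξ t) := by
  let M : AddSubmonoid (T → B) :=
    { carrier := {f | Continuous f}
      zero_mem' := continuous_const
      add_mem' := fun hf hg => Continuous.add hf hg }
  refine S.map_mem_of_wordFamily i (M := M) (fun _ => (S.P : F →+ B)) (fun n _ c hc => ?_) hξ
  change Continuous fun t => S.P (S.word i n (c t))
  simp only [P_word]
  split_ifs <;> fun_prop

end Family

/-- The operator `L_i + ∑_{n < m} V_{i,n}(αₙ)`. -/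
def canonical (α : (n : ℕ) → ContinuousMultilinearMap ℂ (fun _ : Fin n => B) B) (m : ℕ) :
    F →L[ℂ] F :=
  S.L i + ∑ n ∈ Finset.range m, S.V i n (α n)

variable (α : (n : ℕ) → ContinuousMultilinearMap ℂ (fun _ : Fin n => B) B)

lemma canonical_apply (m : ℕ) (x : F) :
    S.canonical i α m x = S.L i x + ∑ n ∈ Finset.range m, S.V i n (α n) x := by
  simp [canonical]

lemma canonical_succ_apply (m : ℕ) (x : F) :
    S.canonical i α (m + 1) x = S.canonical i α m x + S.V i m (α m) x := by
  simp only [canonical_apply, Finset.sum_range_succ, add_assoc]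

lemma canonical_congr {α β : (n : ℕ) → ContinuousMultilinearMap ℂ (fun _ : Fin n => B) B} {m : ℕ}
    (h : ∀ n < m, α n = β n) : S.canonical i α m = S.canonical i β m := by
  simp only [canonical]
  congr 1
  exact Finset.sum_congr rfl fun n hn => by rw [h n (Finset.mem_range.1 hn)]

section Family

variable {T : Type*} [TopologicalSpace T]

lemma sum_V_mem {M : AddSubmonoid (T → F)} (m : ℕ) {ξ : T → F}
    (h : ∀ n, (fun t => S.V i n (α n) (ξ t)) ∈ M) :
    (fun t => ∑ n ∈ Finset.range m, S.V i n (α n) (ξ t)) ∈ M := by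
  have := M.sum_mem (t := Finset.range m) fun n _ => h n
  convert this using 1
  funext t
  simp

lemma canonical_mem_wordFamily (m : ℕ) {k : ℕ} {ξ : T → F} (hξ : ξ ∈ S.wordFamily i T k) :
    (fun t => S.canonical i α m (ξ t)) ∈ S.wordFamily i T (k + 1) := by
  simp only [canonical_apply]
  exact AddSubmonoid.add_mem _ (S.L_mem_wordFamily i hξ)
    (S.sum_V_mem i α m fun n =>
      S.wordFamily_mono i k.le_succ (S.V_mem_wordFamily i n (α n) hξ))

lemma canonical_eq_of_mem_wordFamily {k m : ℕ} (h : k ≤ m) {ξ : T → F}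
    (hξ : ξ ∈ S.wordFamily i T k) (t : T) :
    S.canonical i α m (ξ t) = S.canonical i α k (ξ t) := by
  induction m, h using Nat.le_induction with
  | base => rfl
  | succ m hm ih =>
    rw [canonical_succ_apply, ih, S.V_eq_zero_of_mem_wordFamily i hm (α m) hξ, add_zero]

/-- The vector `b₀ X b₁ X ⋯ b_{k-1} X Ω`. -/
def orbit (X : F →L[ℂ] F) {k : ℕ} (b : Fin k → B) : F :=
  (List.ofFn fun j => S.lam (b j) * X).prod S.Ω

lemma orbit_succ (X : F →L[ℂ] F) {k : ℕ} (b : Fin (k + 1) → B) :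
    S.orbit X b = S.lam (b 0) (X (S.orbit X fun j => b j.succ)) := by
  simp [orbit, List.ofFn_succ]

/-- The top-degree part of `b₀ X b₁ X ⋯ b_{k-1} X Ω` is `b₀ δᵢ ⊗ ⋯ ⊗ b_{k-1} δᵢ ⊗ 1`. -/
lemma exists_orbit_canonical_eq (m : ℕ) {k : ℕ} {b : T → Fin k → B} (hb : Continuous b) :
    ∃ ζ ∈ S.wordFamily i T k, ∀ t, S.orbit (S.canonical i α m) (b t) =
      S.word i k (Fin.snoc (b t) 1) + ζ t := by
  induction k with
  | zero => exact ⟨0, AddSubmonoid.zero_mem _, fun t => by simp [orbit, word, Fin.snoc]⟩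
  | succ k ih =>
    obtain ⟨ζ, hζ, h⟩ := ih (b := fun t j => b t j.succ) (by fun_prop)
    have hw : Continuous fun t => (Fin.snoc (fun j : Fin k => b t j.succ) 1 : Fin (k + 1) → B) :=
      Continuous.finSnoc (by fun_prop) continuous_const
    refine ⟨fun t => S.lam (b t 0) (∑ n ∈ Finset.range m,
        S.V i n (α n) (S.word i k (Fin.snoc (fun j : Fin k => b t j.succ) 1))
        + S.canonical i α m (ζ t)),
      S.lam_mem_wordFamily i (by fun_prop) (AddSubmonoid.add_mem _
        (S.sum_V_mem i α m fun n => S.V_word_mem_wordFamily i n (α n) hw)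
        (S.canonical_mem_wordFamily i α m hζ)), fun t => ?_⟩
    have hc : Function.update (Fin.cons 1 (Fin.snoc (fun j : Fin k => b t j.succ) 1)) 0 (b t 0) =
        (Fin.snoc (b t) 1 : Fin (k + 1 + 1) → B) := by
      rw [Fin.update_cons_zero, Fin.cons_snoc_eq_snoc_cons]
      congr 1
      exact Fin.cons_self_tail (b t)
    rw [orbit_succ, h, map_add, S.canonical_apply, L_word, add_assoc, map_add, lam_word,
      Fin.cons_zero, mul_one, hc]

lemma orbit_canonical_mem_wordFamily (m : ℕ) {k : ℕ} {b : T → Fin k → B} (hb : Continuous b) :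
    (fun t => S.orbit (S.canonical i α m) (b t)) ∈ S.wordFamily i T (k + 1) := by
  obtain ⟨ζ, hζ, h⟩ := S.exists_orbit_canonical_eq i α m hb
  simp only [h]
  exact AddSubmonoid.add_mem _
    (S.word_mem_wordFamily i k.lt_succ_self (hb.finSnoc continuous_const))
    (S.wordFamily_mono i k.le_succ hζ)

end Family

lemma orbit_canonical_eq {k m : ℕ} (h : k ≤ m) (b : Fin k → B) :
    S.orbit (S.canonical i α m) b = S.orbit (S.canonical i α k) b := by
  suffices ∀ k l m, k ≤ l → l ≤ m → ∀ b : Fin k → B,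
      S.orbit (S.canonical i α m) b = S.orbit (S.canonical i α l) b from this k k m le_rfl h b
  intro k
  induction k with
  | zero => intros; simp [orbit]
  | succ k ih =>
    intro l m hl hm b
    have hmem := S.orbit_canonical_mem_wordFamily i α l (continuous_id (X := Fin k → B))
    have eq (n : ℕ) (hn : k + 1 ≤ n) := S.canonical_eq_of_mem_wordFamily i α hn hmem
      fun j => b j.succ
    simp only [id_eq] at eq
    rw [orbit_succ, orbit_succ, ih l m (by omega) hm, eq m (by omega), eq l hl]

lemma V_orbit_canonical (m : ℕ) {k : ℕ} (β : ContinuousMultilinearMap ℂ (fun _ : Fin k => B) B)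
    (b : Fin k → B) : S.V i k β (S.orbit (S.canonical i α m) b) = S.lam (β b) S.Ω := by
  obtain ⟨ζ, hζ, h⟩ := S.exists_orbit_canonical_eq i α m (continuous_id (X := Fin k → B))
  have := S.V_word_add i k 0 β (Fin.snoc b 1)
  rw [show b = id b from rfl, h, map_add, S.V_eq_zero_of_mem_wordFamily i le_rfl β hζ, add_zero]
  refine this.trans ?_
  have h1 : (fun j : Fin k => (Fin.snoc b 1 : Fin (k + 1) → B) ⟨j, by omega⟩) = b :=
    funext fun j => Fin.snoc_castSucc (α := fun _ => B) 1 b j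
  have h2 : (Fin.snoc b 1 : Fin (k + 1) → B) ⟨k, by omega⟩ = 1 :=
    Fin.snoc_last (α := fun _ => B) 1 b
  change S.lam (β fun j : Fin k => (Fin.snoc b 1 : Fin (k + 1) → B) ⟨j, by omega⟩)
    (S.lam ((Fin.snoc b 1 : Fin (k + 1) → B) ⟨k, by omega⟩) S.Ω) = _
  rw [h1, h2, map_one, one_apply_eq_self, id_eq]

/-- The moment `(b₁, …, b_k) ↦ ℰ(X b₁ X ⋯ b_k X)` of `X = L_i + ∑_{n < m} V_{i,n}(αₙ)`. -/
def canonicalMoment (m k : ℕ) : ContinuousMultilinearMap ℂ (fun _ : Fin k => B) B where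
  toMultilinearMap :=
    ((S.P ∘L S.canonical i α m ∘L ContinuousLinearMap.apply ℂ F S.Ω).toLinearMap.compMultilinearMap
      ((MultilinearMap.mkPiAlgebraFin ℂ k (F →L[ℂ] F)).compLinearMap fun _ =>
        (LinearMap.mulRight ℂ (S.canonical i α m)).comp S.lam.toLinearMap))
  cont := S.continuous_P_of_mem_wordFamily i
    (S.canonical_mem_wordFamily i α m (S.orbit_canonical_mem_wordFamily i α m continuous_id))

lemma canonicalMoment_apply (m k : ℕ) (b : Fin k → B) :
    S.canonicalMoment i α m k b =
      S.P (S.canonical i α m (S.orbit (S.canonical i α m) b)) := rfl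

lemma Ec_canonical {k m : ℕ} (h : k < m) (b : Fin (k + 1) → B) :
    S.Ec (List.ofFn fun j => S.lam (b j) * S.canonical i α m).prod =
      b 0 * (S.canonicalMoment i α k k (fun j => b j.succ) + α k fun j => b j.succ) := by
  have hmem := S.orbit_canonical_mem_wordFamily i α k (continuous_id (X := Fin k → B))
  have heq := S.canonical_eq_of_mem_wordFamily i α h hmem fun j => b j.succ
  simp only [id_eq] at heq
  change S.P (S.orbit _ b) = _
  rw [orbit_succ, P_lam, S.orbit_canonical_eq i α h.le, heq, canonical_succ_apply, map_add,
    V_orbit_canonical, P_lam_omega, canonicalMoment_apply]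

end FockSetup

namespace NCPS

variable {A : Type*} [NormedRing A] [NormedAlgebra ℂ A] [CompleteSpace A] (P : NCPS B A)

/-- The moment `(b₁, …, b_k) ↦ E(a b₁ a ⋯ b_k a)`. -/
def moment (a : A) (k : ℕ) : ContinuousMultilinearMap ℂ (fun _ : Fin k => B) B :=
  (P.E ∘L ContinuousLinearMap.mul ℂ A a).compContinuousMultilinearMap
    ((ContinuousMultilinearMap.mkPiAlgebraFin ℂ k A).compContinuousLinearMap fun _ =>
      (ContinuousLinearMap.mul ℂ A).flip a ∘L ⟨P.ι.toLinearMap, P.isometry.continuous⟩)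

lemma E_prod_ofFn (a : A) {k : ℕ} (b : Fin (k + 1) → B) :
    P.E (List.ofFn fun j => P.ι (b j) * a).prod = b 0 * P.moment a k fun j => b j.succ := by
  have h : P.moment a k (fun j => b j.succ) =
      P.E (a * (List.ofFn fun j : Fin k => P.ι (b j.succ) * a).prod) := rfl
  have := P.cond_exp (a * (List.ofFn fun j : Fin k => P.ι (b j.succ) * a).prod) (b 0) 1
  rw [h, List.ofFn_succ, List.prod_cons, mul_assoc]
  simpa using this

/-- The maps `αₙ`, defined recursively so that each moment of the canonical operator agrees with
that of `a`. -/
def cumulant (S : FockSetup B I F) (i : I) (a : A) (k : ℕ) :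
    ContinuousMultilinearMap ℂ (fun _ : Fin k => B) B :=
  P.moment a k -
    S.canonicalMoment i (fun n => if n < k then cumulant S i a n else 0) k k
termination_by k

lemma canonicalMoment_add_cumulant (S : FockSetup B I F) (i : I) (a : A) (k : ℕ) :
    S.canonicalMoment i (P.cumulant S i a) k k + P.cumulant S i a k = P.moment a k := by
  have h : S.canonicalMoment i (fun n => if n < k then P.cumulant S i a n else 0) k k =
      S.canonicalMoment i (P.cumulant S i a) k k := by
    ext b
    simp only [FockSetup.canonicalMoment_apply]
    rw [S.canonical_congr i fun n hn => if_pos hn]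
  conv_lhs => rw [cumulant.eq_1 P S i a k, h]
  abel

end NCPS

/-- Proposition 4.4: moments of an arbitrary element `a` can be matched, up to order `N`, by an
operator `X = L_i + ∑_{n=0}^{N} V_{i,n}(αₙ)` on the Fock space. -/
theorem stmt_16 {A : Type*} [NormedRing A] [NormedAlgebra ℂ A] [CompleteSpace A]
    (P : NCPS B A) (S : FockSetup B I F) (a : A) (N : ℕ) (hN : 1 ≤ N) (i : I) :
    ∃ α : (n : ℕ) → ContinuousMultilinearMap ℂ (fun _ : Fin n => B) B,
      ∀ X : F →L[ℂ] F, X = S.L i + ∑ n ∈ Finset.range (N + 1), S.V i n (α n) →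
        ∀ k : ℕ, 1 ≤ k → k ≤ N → ∀ b : Fin (k + 1) → B,
          S.Ec (List.ofFn fun j => S.lam (b j) * X).prod =
            P.E (List.ofFn fun j => P.ι (b j) * a).prod := by
  refine ⟨P.cumulant S i a, ?_⟩
  rintro X rfl k - hk b
  rw [P.E_prod_ofFn, ← P.canonicalMoment_add_cumulant S i a k]
  exact S.Ec_canonical i _ (Nat.lt_succ_of_le hk) b
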